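/- arXiv:2010.13472 — 2 statements merged into one kernel-verified Lean document; each statement's English description precedes it below -/
import Mathlib

section
/- Proposition (Appendix B.1, cross-entropy term of the Hensman-type GP-VAE): Under the sparse GP setup, ∫_{ℝ^N} N(z | Bμ, K̃ + B A Bᵀ) · (∑_{i=1}^N log N(zᵢ | ỹᵢ, σ̃ᵢ²)) dz = ∑_{i=1}^N [ log N(ỹᵢ | kᵢᵀ K_mm^{−1} μ, σ̃ᵢ²) − (1/(2 σ̃ᵢ²)) (K̃ᵢᵢ + Tr(A Λᵢ)) ], where K̃ᵢᵢ is the i-th diagonal entry of K̃ and Λᵢ := K_mm^{−1} kᵢ kᵢᵀ K_mm^{−1}. -/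
open MeasureTheory Matrix Real
open scoped BigOperators

/-- Multivariate Gaussian density `N(x | m, S)`. -/
noncomputable def gaussN {n : ℕ} (m : Fin n → ℝ) (S : Matrix (Fin n) (Fin n) ℝ)
    (x : Fin n → ℝ) : ℝ :=
  (2 * π) ^ (-(n : ℝ) / 2) * S.det ^ (-(1 : ℝ) / 2) *
    Real.exp (-(1 / 2) * ((x - m) ⬝ᵥ (S⁻¹ *ᵥ (x - m))))

/-- One-dimensional Gaussian density `N(x | m, v)` with variance `v`. -/
noncomputable def gauss1 (x m v : ℝ) : ℝ :=
  (2 * π * v) ^ (-(1 : ℝ) / 2) * Real.exp (-((x - m) ^ 2) / (2 * v))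

open ProbabilityTheory

/-- The product of standard Gaussian measures has the product density with respect to Lebesgue
measure. -/
lemma pi_gaussianReal_eq_withDensity (ι : Type*) [Fintype ι] :
    Measure.pi (fun _ : ι ↦ gaussianReal 0 1) =
      (volume : Measure (ι → ℝ)).withDensity
        (fun x ↦ ENNReal.ofReal (∏ i, gaussianPDFReal 0 1 (x i))) := by
  refine Measure.pi_eq fun s hs ↦ ?_
  have hint (i : ι) : Integrable (gaussianPDFReal 0 1) (volume.restrict (s i)) :=
    (integrable_gaussianPDFReal 0 1).restrict
  rw [withDensity_apply _ (MeasurableSet.univ_pi hs), volume_pi, Measure.restrict_pi_pi,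
    ← ofReal_integral_eq_lintegral_ofReal (Integrable.fintype_prod hint)
      (.of_forall fun x ↦ Finset.prod_nonneg fun i _ ↦ gaussianPDFReal_nonneg _ _ _),
    integral_fintype_prod_eq_prod (fun _ : ι ↦ gaussianPDFReal 0 1),
    ENNReal.ofReal_prod_of_nonneg
      fun i _ ↦ integral_nonneg fun x ↦ gaussianPDFReal_nonneg _ _ _]
  simp_rw [gaussianReal_apply_eq_integral 0 one_ne_zero]

lemma integral_pi_gaussianReal {ι : Type*} [Fintype ι] (f : (ι → ℝ) → ℝ) :
    ∫ w, f w ∂Measure.pi (fun _ : ι ↦ gaussianReal 0 1) =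
      ∫ w, (∏ i, gaussianPDFReal 0 1 (w i)) * f w := by
  rw [pi_gaussianReal_eq_withDensity, integral_withDensity_eq_integral_toReal_smul
    (by fun_prop) (.of_forall fun _ ↦ ENNReal.ofReal_lt_top)]
  refine integral_congr_ae (.of_forall fun w ↦ ?_)
  simp only [smul_eq_mul]
  rw [ENNReal.toReal_ofReal (Finset.prod_nonneg fun i _ ↦ gaussianPDFReal_nonneg _ _ _)]

lemma prod_gaussianPDFReal_zero_one {n : ℕ} (w : Fin n → ℝ) :
    ∏ i, gaussianPDFReal 0 1 (w i) =
      (2 * π) ^ (-(n : ℝ) / 2) * Real.exp (-(1 / 2) * (w ⬝ᵥ w)) := by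
  simp_rw [gaussianPDFReal, Finset.prod_mul_distrib, ← Real.exp_sum]
  congr 1
  · rw [Finset.prod_const, Finset.card_univ, Fintype.card_fin, NNReal.coe_one, mul_one,
      Real.sqrt_eq_rpow, ← Real.rpow_neg (by positivity), ← Real.rpow_natCast,
      ← Real.rpow_mul (by positivity)]
    ring_nf
  · simp only [dotProduct, Finset.mul_sum]
    congr 1
    refine Finset.sum_congr rfl fun i _ ↦ ?_
    simp
    ring

/-- Change of variables along an invertible affine map. -/
lemma integral_comp_add_mulVec {n : ℕ} (m : Fin n → ℝ) {L : Matrix (Fin n) (Fin n) ℝ}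
    (hL : L.det ≠ 0) {f : (Fin n → ℝ) → ℝ} (hf : Continuous f) :
    ∫ z, f z = |L.det| * ∫ w, f (m + L *ᵥ w) := by
  have hmap := integral_map (μ := volume) (φ := toLin' L) (f := fun z ↦ f (m + z))
    (LinearMap.continuous_of_finiteDimensional _).aemeasurable
    (by fun_prop : Continuous fun z ↦ f (m + z)).aestronglyMeasurable
  rw [Real.map_matrix_volume_pi_eq_smul_volume_pi hL, integral_smul_measure,
    integral_add_left_eq_self f m, ENNReal.toReal_ofReal (abs_nonneg _)] at hmap
  simp only [toLin'_apply, smul_eq_mul] at hmap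
  rw [← hmap, abs_inv, mul_inv_cancel_left₀ (abs_ne_zero.mpr hL)]

lemma continuous_gaussN {n : ℕ} (m : Fin n → ℝ) (S : Matrix (Fin n) (Fin n) ℝ) :
    Continuous (gaussN m S) := by
  unfold gaussN
  fun_prop

lemma gaussN_add_mulVec {n : ℕ} (m : Fin n → ℝ) {L : Matrix (Fin n) (Fin n) ℝ}
    (hL : L.det ≠ 0) (w : Fin n → ℝ) :
    |L.det| * gaussN m (L * Lᵀ) (m + L *ᵥ w) = ∏ i, gaussianPDFReal 0 1 (w i) := by
  have hu : IsUnit L.det := hL.isUnit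
  have hquad : (L *ᵥ w) ⬝ᵥ ((L * Lᵀ)⁻¹ *ᵥ (L *ᵥ w)) = w ⬝ᵥ w := by
    rw [Matrix.mul_inv_rev, mulVec_mulVec, Matrix.mul_assoc, nonsing_inv_mul _ hu, Matrix.mul_one,
      ← transpose_nonsing_inv, dotProduct_mulVec, vecMul_transpose, mulVec_mulVec,
      nonsing_inv_mul _ hu, one_mulVec]
  have hdet : |L.det| * (L * Lᵀ).det ^ (-(1 : ℝ) / 2) = 1 := by
    rw [det_mul, det_transpose, ← abs_mul_abs_self, ← sq, ← Real.rpow_natCast,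
      ← Real.rpow_mul (abs_nonneg _)]
    norm_num
    rw [Real.rpow_neg_one, mul_inv_cancel₀ (abs_ne_zero.mpr hL)]
  rw [prod_gaussianPDFReal_zero_one, gaussN, add_sub_cancel_left, hquad]
  linear_combination (2 * π) ^ (-(n : ℝ) / 2) * Real.exp (-(1 / 2) * (w ⬝ᵥ w)) * hdet

/-- Integrals against a Gaussian density are expectations of an affine image of a standard
Gaussian vector. -/
lemma integral_gaussN_mul {n : ℕ} (m : Fin n → ℝ) {L : Matrix (Fin n) (Fin n) ℝ}
    (hL : L.det ≠ 0) {f : (Fin n → ℝ) → ℝ} (hf : Continuous f) :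
    ∫ z, gaussN m (L * Lᵀ) z * f z =
      ∫ w, f (m + L *ᵥ w) ∂Measure.pi (fun _ : Fin n ↦ gaussianReal 0 1) := by
  rw [integral_comp_add_mulVec m hL (f := fun z ↦ gaussN m (L * Lᵀ) z * f z)
      ((continuous_gaussN _ _).mul hf), integral_pi_gaussianReal,
    ← integral_const_mul]
  simp_rw [← gaussN_add_mulVec m hL, mul_assoc]

lemma memLp_two_dotProduct_pi_gaussianReal {ι : Type*} [Fintype ι] (a : ι → ℝ) :
    MemLp (fun w : ι → ℝ ↦ a ⬝ᵥ w) 2 (Measure.pi fun _ : ι ↦ gaussianReal 0 1) := by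
  refine memLp_finsetSum _ fun j _ ↦ MemLp.const_mul ?_ _
  exact (memLp_id_gaussianReal' 2 (by simp)).comp_measurePreserving (measurePreserving_eval _ j)

lemma integral_dotProduct_pi_gaussianReal {ι : Type*} [Fintype ι] (a : ι → ℝ) :
    ∫ w, a ⬝ᵥ w ∂Measure.pi (fun _ : ι ↦ gaussianReal 0 1) = 0 := by
  simp_rw [dotProduct]
  rw [integral_finsetSum]
  · simp [integral_const_mul, integral_eval]
  · exact fun i _ ↦ (integrable_eval IsGaussian.integrable_id).const_mul _

lemma variance_dotProduct_pi_gaussianReal {ι : Type*} [Fintype ι] (a : ι → ℝ) :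
    Var[fun w ↦ a ⬝ᵥ w; Measure.pi fun _ : ι ↦ gaussianReal 0 1] = a ⬝ᵥ a := by
  have h := variance_sum_pi (μ := fun _ : ι ↦ gaussianReal 0 1) (X := fun j x ↦ a j * x)
    fun j ↦ (memLp_id_gaussianReal' 2 (by simp)).const_mul (a j)
  have hsum : (∑ j, fun w : ι → ℝ ↦ a j * w j) = fun w ↦ a ⬝ᵥ w := by
    ext w
    simp [dotProduct]
  rw [hsum] at h
  rw [h]
  refine Finset.sum_congr rfl fun j _ ↦ ?_
  rw [variance_const_mul, variance_fun_id_gaussianReal, NNReal.coe_one, mul_one, sq]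

lemma integrable_sq_add_dotProduct_pi_gaussianReal {ι : Type*} [Fintype ι] (c : ℝ) (a : ι → ℝ) :
    Integrable (fun w : ι → ℝ ↦ (c + a ⬝ᵥ w) ^ 2)
      (Measure.pi fun _ : ι ↦ gaussianReal 0 1) :=
  ((memLp_const c).add (memLp_two_dotProduct_pi_gaussianReal a)).integrable_sq

lemma integral_sq_add_dotProduct_pi_gaussianReal {ι : Type*} [Fintype ι] (c : ℝ) (a : ι → ℝ) :
    ∫ w, (c + a ⬝ᵥ w) ^ 2 ∂Measure.pi (fun _ : ι ↦ gaussianReal 0 1) = c ^ 2 + a ⬝ᵥ a := by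
  have hX := memLp_two_dotProduct_pi_gaussianReal a
  have hvar := variance_eq_sub ((memLp_const c).add hX)
  have hmean : ∫ w, (c + a ⬝ᵥ w) ∂Measure.pi (fun _ : ι ↦ gaussianReal 0 1) = c := by
    rw [integral_add (integrable_const c) (hX.integrable one_le_two),
      integral_dotProduct_pi_gaussianReal]
    simp
  have hshift : Var[fun w ↦ c + a ⬝ᵥ w; Measure.pi fun _ : ι ↦ gaussianReal 0 1] = a ⬝ᵥ a := by
    rw [variance_const_add hX.aestronglyMeasurable, variance_dotProduct_pi_gaussianReal]
  change Var[fun w ↦ c + a ⬝ᵥ w; _] = (∫ w, (c + a ⬝ᵥ w) ^ 2 ∂_) - (∫ w, (c + a ⬝ᵥ w) ∂_) ^ 2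
    at hvar
  rw [hmean, hshift] at hvar
  linarith

/-- A positive definite real matrix is `L * Lᵀ` for an invertible `L`. -/
lemma Matrix.PosDef.exists_eq_mul_transpose {n : Type*} [Fintype n] [DecidableEq n]
    {S : Matrix n n ℝ} (hS : S.PosDef) : ∃ L : Matrix n n ℝ, L.det ≠ 0 ∧ S = L * Lᵀ := by
  open scoped MatrixOrder in
  obtain ⟨L, hL⟩ := CStarAlgebra.nonneg_iff_eq_mul_star_self.mp hS.posSemidef.nonneg
  rw [star_eq_conjTranspose, conjTranspose_eq_transpose_of_trivial] at hL
  refine ⟨L, fun h0 ↦ hS.det_pos.ne' ?_, hL⟩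
  rw [hL, det_mul, h0, zero_mul]

/-- Second moment of a coordinate, weighted and summed, under a Gaussian density. -/
lemma integral_gaussN_mul_sum {n : ℕ} (m : Fin n → ℝ) {S : Matrix (Fin n) (Fin n) ℝ}
    (hS : S.PosDef) (a b y : Fin n → ℝ) :
    ∫ z, gaussN m S z * ∑ i, (a i - b i * (z i - y i) ^ 2) =
      ∑ i, (a i - b i * ((m i - y i) ^ 2 + S i i)) := by
  obtain ⟨L, hL, rfl⟩ := hS.exists_eq_mul_transpose
  rw [integral_gaussN_mul m hL (by fun_prop)]
  have hterm (i : Fin n) (w : Fin n → ℝ) :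
      (m + L *ᵥ w) i - y i = (m i - y i) + L.row i ⬝ᵥ w := by
    rw [Pi.add_apply, add_sub_right_comm]
    rfl
  simp_rw [hterm]
  have hint (i : Fin n) : Integrable (fun w ↦ b i * (m i - y i + L.row i ⬝ᵥ w) ^ 2)
      (Measure.pi fun _ : Fin n ↦ gaussianReal 0 1) :=
    (integrable_sq_add_dotProduct_pi_gaussianReal _ _).const_mul _
  rw [integral_finsetSum]
  swap
  · exact fun i _ ↦ (integrable_const _).sub (hint i)
  refine Finset.sum_congr rfl fun i _ ↦ ?_
  rw [integral_sub (integrable_const _) (hint i), integral_const_mul,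
    integral_sq_add_dotProduct_pi_gaussianReal]
  simp [mul_apply, dotProduct]

lemma log_gauss1 (x m : ℝ) {v : ℝ} (hv : 0 < v) :
    Real.log (gauss1 x m v) =
      Real.log ((2 * π * v) ^ (-(1 : ℝ) / 2)) - 1 / (2 * v) * (x - m) ^ 2 := by
  rw [gauss1, Real.log_mul (by positivity) (by positivity), Real.log_exp]
  ring

lemma trace_mul_mul_vecMulVec_mul {n : Type*} [Fintype n] (A P : Matrix n n ℝ) (k : n → ℝ) :
    (A * (P * vecMulVec k k * P)).trace = (k ᵥ* P) ⬝ᵥ (A *ᵥ (P *ᵥ k)) := by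
  rw [mul_vecMulVec, vecMulVec_mul, mul_vecMulVec, trace_vecMulVec, dotProduct_comm]

theorem stmt4 (N m : ℕ)
    (Kmm : Matrix (Fin m) (Fin m) ℝ) (hKmm : Kmm.PosDef)
    (KNm : Matrix (Fin N) (Fin m) ℝ)
    (KNN : Matrix (Fin N) (Fin N) ℝ) (hKNN : KNN.IsSymm)
    (B : Matrix (Fin N) (Fin m) ℝ) (hB : B = KNm * Kmm⁻¹)
    (Ktil : Matrix (Fin N) (Fin N) ℝ) (hKtil : Ktil = KNN - KNm * Kmm⁻¹ * KNmᵀ)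
    (μ : Fin m → ℝ)
    (A : Matrix (Fin m) (Fin m) ℝ) (hA : A.PosSemidef)
    (hcov : (Ktil + B * A * Bᵀ).PosDef)
    (ytil : Fin N → ℝ) (σ : Fin N → ℝ) (hσ : ∀ i, 0 < σ i)
    (Λ : Fin N → Matrix (Fin m) (Fin m) ℝ)
    (hΛ : ∀ i, Λ i = Kmm⁻¹ * vecMulVec (KNm i) (KNm i) * Kmm⁻¹) :
    ∫ z : Fin N → ℝ,
        gaussN (B *ᵥ μ) (Ktil + B * A * Bᵀ) z *
          (∑ i, Real.log (gauss1 (z i) (ytil i) ((σ i) ^ 2)))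
      = ∑ i, (Real.log (gauss1 (ytil i) ((KNm i) ⬝ᵥ (Kmm⁻¹ *ᵥ μ)) ((σ i) ^ 2))
          - (1 / (2 * (σ i) ^ 2)) * (Ktil i i + (A * Λ i).trace)) := by
  have hentry (i : Fin N) : (Ktil + B * A * Bᵀ) i i = Ktil i i + (A * Λ i).trace := by
    have hsymm : (Kmm⁻¹)ᵀ = Kmm⁻¹ := by
      simpa [conjTranspose_eq_transpose_of_trivial] using hKmm.inv.isHermitian.eq
    have hrow : B i = KNm i ᵥ* Kmm⁻¹ := by
      rw [hB]
      rfl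
    have hcol : Kmm⁻¹ *ᵥ KNm i = B i := by
      rw [hrow, ← vecMul_transpose, hsymm]
    rw [hΛ, trace_mul_mul_vecMulVec_mul, hcol, ← hrow, Matrix.add_apply, dotProduct_mulVec]
    rfl
  have hmean (i : Fin N) : (B *ᵥ μ) i = KNm i ⬝ᵥ (Kmm⁻¹ *ᵥ μ) := by
    rw [hB, ← mulVec_mulVec]
    rfl
  simp_rw [fun i x y ↦ log_gauss1 x y (pow_pos (hσ i) 2)]
  rw [integral_gaussN_mul_sum _ hcov]
  refine Finset.sum_congr rfl fun i _ ↦ ?_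
  rw [hentry, hmean]
  ring
end

section
/- Closed form of the Kullback–Leibler divergence between multivariate Gaussians (the KL term of the Hensman bound): for n ∈ ℕ, μ₁, μ₂ ∈ ℝⁿ and symmetric positive definite S₁, S₂ ∈ ℝ^{n×n}, ∫_{ℝⁿ} N(z | μ₁, S₁) · (log N(z | μ₁, S₁) − log N(z | μ₂, S₂)) dz = (1/2) ( Tr(S₂^{−1} S₁) + (μ₂ − μ₁)ᵀ S₂^{−1} (μ₂ − μ₁) − n + log det S₂ − log det S₁ ). -/
open MeasureTheory Matrix Real
open scoped BigOperators

open ProbabilityTheory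

/-- Monomials are integrable against the standard Gaussian density. -/
lemma integrable_gaussianPDFReal_mul_pow (k : ℕ) :
    Integrable fun x : ℝ => gaussianPDFReal 0 1 x * x ^ k := by
  have h : Integrable (fun x : ℝ => x ^ k) (gaussianReal 0 1) := by
    refine (integrable_norm_iff (by fun_prop)).1 ?_
    simpa using (memLp_id_gaussianReal (μ := 0) (v := 1) k).integrable_norm_pow'
  rw [gaussianReal_of_var_ne_zero _ one_ne_zero,
    integrable_withDensity_iff_integrable_smul' (measurable_gaussianPDF _ _)
      (ae_of_all _ fun _ => gaussianPDF_lt_top)] at h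
  simpa [toReal_gaussianPDF] using h

lemma integral_gaussianPDFReal_mul_self :
    ∫ x : ℝ, gaussianPDFReal 0 1 x * x = 0 := by
  have h := integral_gaussianReal_eq_integral_smul (μ := 0) (v := 1) (f := fun x : ℝ => x)
    one_ne_zero
  simpa using h.symm

lemma integral_gaussianPDFReal_mul_sq :
    ∫ x : ℝ, gaussianPDFReal 0 1 x * x ^ 2 = 1 := by
  have h := integral_gaussianReal_eq_integral_smul (μ := 0) (v := 1) (f := fun x : ℝ => x ^ 2)
    one_ne_zero
  have hv := variance_fun_id_gaussianReal (μ := 0) (v := 1)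
  rw [variance_eq_integral measurable_id'.aemeasurable] at hv
  simp only [integral_id_gaussianReal, sub_zero] at hv
  simpa [hv] using h.symm

section StandardGaussian

variable {ι : Type*} [Fintype ι]

/-- The density of the standard Gaussian on `ι → ℝ`. -/
noncomputable def stdGaussianPDF (x : ι → ℝ) : ℝ := ∏ k, gaussianPDFReal 0 1 (x k)

lemma stdGaussianPDF_mul_monomial (e : ι → ℕ) (x : ι → ℝ) :
    stdGaussianPDF x * ∏ k, x k ^ e k = ∏ k, gaussianPDFReal 0 1 (x k) * x k ^ e k :=
  Finset.prod_mul_distrib.symm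

lemma integrable_stdGaussianPDF_mul_monomial (e : ι → ℕ) :
    Integrable fun x : ι → ℝ => stdGaussianPDF x * ∏ k, x k ^ e k := by
  simp_rw [stdGaussianPDF_mul_monomial]
  exact Integrable.fintype_prod fun k => integrable_gaussianPDFReal_mul_pow (e k)

lemma integral_stdGaussianPDF_mul_monomial (e : ι → ℕ) :
    ∫ x : ι → ℝ, stdGaussianPDF x * ∏ k, x k ^ e k =
      ∏ k, ∫ x : ℝ, gaussianPDFReal 0 1 x * x ^ e k := by
  simp_rw [stdGaussianPDF_mul_monomial]
  exact integral_fintype_prod_volume_eq_prod fun k x => gaussianPDFReal 0 1 x * x ^ e k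

lemma integrable_stdGaussianPDF : Integrable (stdGaussianPDF : (ι → ℝ) → ℝ) := by
  simpa using integrable_stdGaussianPDF_mul_monomial (0 : ι → ℕ)

lemma integral_stdGaussianPDF : ∫ x : ι → ℝ, stdGaussianPDF x = 1 := by
  simpa [integral_gaussianPDFReal_eq_one] using
    integral_stdGaussianPDF_mul_monomial (0 : ι → ℕ)

variable [DecidableEq ι]

lemma prod_pow_single (x : ι → ℝ) (i : ι) : ∏ k, x k ^ (Pi.single i 1 : ι → ℕ) k = x i := by
  simp [Pi.single_apply, pow_ite]

lemma prod_pow_single_add_single (x : ι → ℝ) (i j : ι) :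
    ∏ k, x k ^ (Pi.single i 1 + Pi.single j 1 : ι → ℕ) k = x i * x j := by
  simp only [Pi.add_apply, pow_add, Finset.prod_mul_distrib, prod_pow_single]

lemma integrable_stdGaussianPDF_mul_eval (i : ι) :
    Integrable fun x : ι → ℝ => stdGaussianPDF x * x i := by
  simpa only [prod_pow_single] using integrable_stdGaussianPDF_mul_monomial (Pi.single i 1)

lemma integral_stdGaussianPDF_mul_eval (i : ι) :
    ∫ x : ι → ℝ, stdGaussianPDF x * x i = 0 := by
  have h := integral_stdGaussianPDF_mul_monomial (Pi.single i 1 : ι → ℕ)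
  simp only [prod_pow_single] at h
  rw [h]
  exact Finset.prod_eq_zero (Finset.mem_univ i) (by simpa using integral_gaussianPDFReal_mul_self)

lemma integrable_stdGaussianPDF_mul_eval_mul_eval (i j : ι) :
    Integrable fun x : ι → ℝ => stdGaussianPDF x * (x i * x j) := by
  have h := integrable_stdGaussianPDF_mul_monomial (Pi.single i 1 + Pi.single j 1 : ι → ℕ)
  simp only [prod_pow_single_add_single] at h
  exact h

lemma integral_stdGaussianPDF_mul_eval_mul_eval (i j : ι) :
    ∫ x : ι → ℝ, stdGaussianPDF x * (x i * x j) = if i = j then 1 else 0 := by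
  have h := integral_stdGaussianPDF_mul_monomial (Pi.single i 1 + Pi.single j 1 : ι → ℕ)
  simp only [prod_pow_single_add_single] at h
  rw [h]
  split_ifs with hij
  · subst hij
    refine Finset.prod_eq_one fun k _ => ?_
    by_cases hk : k = i
    · subst hk
      simpa using integral_gaussianPDFReal_mul_sq
    · simpa [hk] using integral_gaussianPDFReal_eq_one 0 one_ne_zero
  · refine Finset.prod_eq_zero (Finset.mem_univ i) ?_
    simpa [hij] using integral_gaussianPDFReal_mul_self

/-- Expectation of a quadratic polynomial under the standard Gaussian. -/
lemma integral_stdGaussianPDF_mul_quadratic (M : Matrix ι ι ℝ) (b : ι → ℝ) (c : ℝ) :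
    ∫ x : ι → ℝ, stdGaussianPDF x * (x ⬝ᵥ (M *ᵥ x) + b ⬝ᵥ x + c) = M.trace + c := by
  have expand (x : ι → ℝ) : stdGaussianPDF x * (x ⬝ᵥ (M *ᵥ x) + b ⬝ᵥ x + c) =
      (∑ i, ∑ j, M i j * (stdGaussianPDF x * (x i * x j)))
        + (∑ i, b i * (stdGaussianPDF x * x i)) + c * stdGaussianPDF x := by
    simp only [dotProduct, mulVec, mul_add, Finset.mul_sum]
    congr 1
    · congr 1
      · exact Finset.sum_congr rfl fun i _ => Finset.sum_congr rfl fun j _ => by ring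
      · exact Finset.sum_congr rfl fun i _ => by ring
    · ring
  have int₂ (i j : ι) : Integrable fun x : ι → ℝ => M i j * (stdGaussianPDF x * (x i * x j)) :=
    (integrable_stdGaussianPDF_mul_eval_mul_eval i j).const_mul _
  have int₁ (i : ι) : Integrable fun x : ι → ℝ => b i * (stdGaussianPDF x * x i) :=
    (integrable_stdGaussianPDF_mul_eval i).const_mul _
  have int₂' (i : ι) :
      Integrable fun x : ι → ℝ => ∑ j, M i j * (stdGaussianPDF x * (x i * x j)) :=
    integrable_finsetSum _ fun j _ => int₂ i j
  have int₂'' :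
      Integrable fun x : ι → ℝ => ∑ i, ∑ j, M i j * (stdGaussianPDF x * (x i * x j)) :=
    integrable_finsetSum _ fun i _ => int₂' i
  have int₁' : Integrable fun x : ι → ℝ => ∑ i, b i * (stdGaussianPDF x * x i) :=
    integrable_finsetSum _ fun i _ => int₁ i
  have int₂₁ : Integrable fun x : ι → ℝ =>
      (∑ i, ∑ j, M i j * (stdGaussianPDF x * (x i * x j)))
        + ∑ i, b i * (stdGaussianPDF x * x i) := int₂''.add int₁'
  simp_rw [expand]
  rw [integral_add int₂₁ (integrable_stdGaussianPDF.const_mul c),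
    integral_add int₂'' int₁', integral_finsetSum _ fun i _ => int₂' i,
    integral_finsetSum _ fun i _ => int₁ i]
  simp_rw [integral_finsetSum _ fun j _ => int₂ _ j, integral_const_mul,
    integral_stdGaussianPDF_mul_eval_mul_eval, integral_stdGaussianPDF_mul_eval,
    integral_stdGaussianPDF]
  simp [Matrix.trace]

/-- Affine change of variables for the Lebesgue integral on `ι → ℝ`. -/
lemma integral_eq_integral_comp_affine (A : Matrix ι ι ℝ) (hA : A.det ≠ 0) (m : ι → ℝ)
    (f : (ι → ℝ) → ℝ) :
    ∫ z, f z = ∫ x, |A.det| * f (A *ᵥ x + m) := by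
  have hinj : Function.Injective fun x => A *ᵥ x + m := fun x y h =>
    Matrix.mulVec_injective_of_isUnit ((Matrix.isUnit_iff_isUnit_det A).2 hA.isUnit)
      (add_right_cancel h)
  have hsurj : Function.Surjective fun x => A *ᵥ x + m := fun y =>
    ⟨A⁻¹ *ᵥ (y - m), by simp [Matrix.mulVec_mulVec, Matrix.mul_nonsing_inv A hA.isUnit]⟩
  have hderiv (x : ι → ℝ) : HasFDerivAt (fun x => A *ᵥ x + m)
      (LinearMap.toContinuousLinearMap (Matrix.toLin' A)) x :=
    (LinearMap.toContinuousLinearMap (Matrix.toLin' A)).hasFDerivAt.add_const m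
  have h := integral_image_eq_integral_abs_det_fderiv_smul volume MeasurableSet.univ
    (fun x _ => (hderiv x).hasFDerivWithinAt) hinj.injOn f
  rw [Set.image_univ, hsurj.range_eq, setIntegral_univ, setIntegral_univ] at h
  simpa [ContinuousLinearMap.det] using h

open scoped MatrixOrder Matrix.Norms.L2Operator in
/-- A positive definite matrix factors as `A * Aᵀ` with `A` invertible. -/
lemma Matrix.PosDef.exists_eq_mul_transpose_s12 {S : Matrix ι ι ℝ} (hS : S.PosDef) :
    ∃ A : Matrix ι ι ℝ, A.det ≠ 0 ∧ S = A * Aᵀ := by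
  obtain ⟨B, hB⟩ := CStarAlgebra.nonneg_iff_eq_star_mul_self.mp hS.posSemidef.nonneg
  refine ⟨Bᵀ, fun h => hS.det_pos.ne' ?_, by simpa [Matrix.star_eq_conjTranspose] using hB⟩
  rw [hB, Matrix.det_mul, ← Matrix.det_transpose B, h, mul_zero]

lemma mulVec_dotProduct_inv_mul_transpose (A : Matrix ι ι ℝ) (hA : A.det ≠ 0) (x : ι → ℝ) :
    (A *ᵥ x) ⬝ᵥ ((A * Aᵀ)⁻¹ *ᵥ (A *ᵥ x)) = x ⬝ᵥ x := by
  rw [Matrix.mul_inv_rev, Matrix.mulVec_mulVec, Matrix.mul_assoc,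
    Matrix.nonsing_inv_mul A hA.isUnit, Matrix.mul_one, Matrix.dotProduct_mulVec,
    ← Matrix.mulVec_transpose, Matrix.mulVec_mulVec, ← Matrix.transpose_nonsing_inv,
    Matrix.transpose_transpose, Matrix.nonsing_inv_mul A hA.isUnit, Matrix.one_mulVec]

end StandardGaussian

lemma stdGaussianPDF_eq {n : ℕ} (x : Fin n → ℝ) :
    stdGaussianPDF x = (2 * π) ^ (-(n : ℝ) / 2) * Real.exp (-(1 / 2) * (x ⬝ᵥ x)) := by
  have h2π : (0 : ℝ) < 2 * π := by positivity
  simp only [stdGaussianPDF, gaussianPDFReal, Finset.prod_mul_distrib, ← Real.exp_sum]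
  congr 1
  · rw [Finset.prod_const, Finset.card_univ, Fintype.card_fin, ← Real.rpow_natCast]
    simp only [NNReal.coe_one, mul_one]
    rw [Real.sqrt_eq_rpow, ← Real.rpow_neg h2π.le, ← Real.rpow_mul h2π.le]
    congr 1
    ring
  · simp only [dotProduct, Finset.mul_sum]
    congr 1
    refine Finset.sum_congr rfl fun i _ => ?_
    simp
    ring

/-- Pulling back along `x ↦ A x + m` turns the Gaussian with covariance `A * Aᵀ` into the
standard one. -/
lemma abs_det_mul_gaussN {n : ℕ} (m : Fin n → ℝ) (A : Matrix (Fin n) (Fin n) ℝ)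
    (hA : A.det ≠ 0) (x : Fin n → ℝ) :
    |A.det| * gaussN m (A * Aᵀ) (A *ᵥ x + m) = stdGaussianPDF x := by
  have hdet : |A.det| * (A * Aᵀ).det ^ (-(1 : ℝ) / 2) = 1 := by
    rw [Matrix.det_mul, Matrix.det_transpose, ← abs_mul_abs_self, ← sq, ← Real.rpow_natCast,
      ← Real.rpow_mul (abs_nonneg _)]
    norm_num
    rw [Real.rpow_neg_one, mul_inv_cancel₀ (abs_ne_zero.2 hA)]
  rw [stdGaussianPDF_eq, gaussN, add_sub_cancel_right, mulVec_dotProduct_inv_mul_transpose A hA]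
  linear_combination (2 * π) ^ (-(n : ℝ) / 2) * Real.exp (-(1 / 2) * (x ⬝ᵥ x)) * hdet

lemma log_gaussN {n : ℕ} (m : Fin n → ℝ) {S : Matrix (Fin n) (Fin n) ℝ} (hS : S.PosDef)
    (x : Fin n → ℝ) :
    Real.log (gaussN m S x) = -(n : ℝ) / 2 * Real.log (2 * π) - 1 / 2 * Real.log S.det
      - 1 / 2 * ((x - m) ⬝ᵥ (S⁻¹ *ᵥ (x - m))) := by
  have h2π : (0 : ℝ) < 2 * π := by positivity
  have h₁ := (Real.rpow_pos_of_pos h2π (-(n : ℝ) / 2)).ne'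
  have h₂ := (Real.rpow_pos_of_pos hS.det_pos (-(1 : ℝ) / 2)).ne'
  rw [gaussN, Real.log_mul (mul_ne_zero h₁ h₂) (Real.exp_ne_zero _), Real.log_mul h₁ h₂,
    Real.log_exp, Real.log_rpow h2π, Real.log_rpow hS.det_pos]
  ring

theorem stmt12 (n : ℕ) (μ₁ μ₂ : Fin n → ℝ) (S₁ S₂ : Matrix (Fin n) (Fin n) ℝ)
    (hS₁ : S₁.PosDef) (hS₂ : S₂.PosDef) :
    ∫ z : Fin n → ℝ, gaussN μ₁ S₁ z * (Real.log (gaussN μ₁ S₁ z) - Real.log (gaussN μ₂ S₂ z))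
      = (1 / 2) * ((S₂⁻¹ * S₁).trace + (μ₂ - μ₁) ⬝ᵥ (S₂⁻¹ *ᵥ (μ₂ - μ₁))
        - n + Real.log S₂.det - Real.log S₁.det) := by
  obtain ⟨A, hA, rfl⟩ := hS₁.exists_eq_mul_transpose_s12
  set P := S₂⁻¹ with hP
  set d := μ₂ - μ₁ with hd
  have key (x : Fin n → ℝ) :
      Real.log (gaussN μ₁ (A * Aᵀ) (A *ᵥ x + μ₁)) - Real.log (gaussN μ₂ S₂ (A *ᵥ x + μ₁)) =
        x ⬝ᵥ (((1 / 2 : ℝ) • (Aᵀ * P * A - 1)) *ᵥ x)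
          + (-(1 / 2 : ℝ) • (Aᵀ *ᵥ (P *ᵥ d) + (P * A)ᵀ *ᵥ d)) ⬝ᵥ x
          + 1 / 2 * (d ⬝ᵥ (P *ᵥ d) + Real.log S₂.det - Real.log (A * Aᵀ).det) := by
    have hx : A *ᵥ x + μ₁ - μ₂ = A *ᵥ x - d := by rw [hd]; abel
    have e₁ : x ⬝ᵥ ((Aᵀ * P * A) *ᵥ x) = (A *ᵥ x) ⬝ᵥ (P *ᵥ (A *ᵥ x)) := by
      rw [← Matrix.mulVec_mulVec, ← Matrix.mulVec_mulVec, Matrix.dotProduct_mulVec,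
        Matrix.vecMul_transpose]
    have e₂ : (Aᵀ *ᵥ (P *ᵥ d)) ⬝ᵥ x = (A *ᵥ x) ⬝ᵥ (P *ᵥ d) := by
      rw [dotProduct_comm, Matrix.dotProduct_mulVec, Matrix.vecMul_transpose]
    have e₃ : ((P * A)ᵀ *ᵥ d) ⬝ᵥ x = d ⬝ᵥ (P *ᵥ (A *ᵥ x)) := by
      rw [Matrix.mulVec_transpose, ← Matrix.dotProduct_mulVec, Matrix.mulVec_mulVec]
    rw [log_gaussN _ hS₁, log_gaussN _ hS₂, add_sub_cancel_right, mulVec_dotProduct_inv_mul_transpose A hA, hx, ← hP]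
    simp only [Matrix.smul_mulVec, Matrix.sub_mulVec, Matrix.one_mulVec, dotProduct_smul,
      smul_dotProduct, dotProduct_sub, sub_dotProduct, add_dotProduct, Matrix.mulVec_sub, e₁, e₂,
      e₃, smul_eq_mul]
    ring
  rw [integral_eq_integral_comp_affine A hA μ₁]
  simp_rw [← mul_assoc, abs_det_mul_gaussN μ₁ A hA, key]
  rw [integral_stdGaussianPDF_mul_quadratic, Matrix.trace_smul, Matrix.trace_sub,
    Matrix.trace_one, Matrix.mul_assoc, Matrix.trace_mul_comm, Matrix.mul_assoc,
    Fintype.card_fin, smul_eq_mul]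
  ring
end
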